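/- Let I be an ideal of R. Then for almost all α, the specialization of the S-module IS (the extension of I to S = R_P) satisfies (IS)_α ≅ I_α S_α, the extension of the specialized ideal I_α to S_α. -/

import Mathlib

set_option maxHeartbeats 1000000
set_option synthInstance.maxHeartbeats 1000000

noncomputable section

namespace Spl

open MvPolynomial

/-- "Q(α) holds for almost all α ∈ K^m", i.e. away from a proper algebraic
subvariety of `K^m`. -/
def AlmostAll (K : Type) [Field K] (m : ℕ) (Q : (Fin m → K) → Prop) : Prop :=
  ∃ c : MvPolynomial (Fin m) K, c ≠ 0 ∧ ∀ α : Fin m → K, MvPolynomial.eval α c ≠ 0 → Q α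

variable (k K : Type) [Field k] [Field K] [Algebra k K]

/-- the field k(u) of rational functions in u = (u_1, ..., u_m) -/
abbrev kU (m : ℕ) := FractionRing (MvPolynomial (Fin m) k)

/-- the polynomial ring R = k(u)[X_1, ..., X_n] -/
abbrev Rg (m n : ℕ) := MvPolynomial (Fin n) (kU k m)

/-- the subfield k(α) ⊆ K generated by α = (α_1, ..., α_m) over k -/
abbrev kA {m : ℕ} (α : Fin m → K) := IntermediateField.adjoin k (Set.range α)

/-- the polynomial ring R_α = k(α)[X_1, ..., X_n] -/
abbrev Ra {m : ℕ} (n : ℕ) (α : Fin m → K) := MvPolynomial (Fin n) (kA k K α)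

/-- evaluation u ↦ α, from k[u] to k(α) -/
def evalα {m : ℕ} (α : Fin m → K) : MvPolynomial (Fin m) k →+* kA k K α :=
  (MvPolynomial.aeval fun i =>
    (⟨α i, IntermediateField.subset_adjoin k (Set.range α) ⟨i, rfl⟩⟩ : kA k K α)).toRingHom

/-- the inclusion k[u][X] → R = k(u)[X] -/
def toR (m n : ℕ) : MvPolynomial (Fin n) (MvPolynomial (Fin m) k) →+* Rg k m n :=
  MvPolynomial.map (algebraMap (MvPolynomial (Fin m) k) (kU k m))

/-- substitution u ↦ α, from k[u][X] to R_α = k(α)[X] -/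
def toRa {m : ℕ} (n : ℕ) (α : Fin m → K) :
    MvPolynomial (Fin n) (MvPolynomial (Fin m) k) →+* Ra k K n α :=
  MvPolynomial.map (evalα k K α)

/-- Krull's specialization I_α = { f(α,X) | f(u,X) ∈ I ∩ k[u,X] } of an ideal I ⊆ R
(as an ideal of R_α, i.e. the ideal spanned by the specialized elements). -/
def idealSpec {m : ℕ} (n : ℕ) (α : Fin m → K) (I : Ideal (Rg k m n)) :
    Ideal (Ra k K n α) :=
  Ideal.span (toRa k K n α '' { f | toR k m n f ∈ I })

/-- `ElemSpec k K n α f fα` : fα is the specialization of f ∈ R at α, i.e. writing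
f = p(u,X)/q(u) with q(α) ≠ 0 one has fα = p(α,X)/q(α). -/
def ElemSpec {m : ℕ} (n : ℕ) (α : Fin m → K) (f : Rg k m n) (fα : Ra k K n α) : Prop :=
  ∃ (p : MvPolynomial (Fin n) (MvPolynomial (Fin m) k)) (q : MvPolynomial (Fin m) k),
    evalα k K α q ≠ 0 ∧
    MvPolynomial.C (algebraMap (MvPolynomial (Fin m) k) (kU k m) q) * f = toR k m n p ∧
    MvPolynomial.C (evalα k K α q) * fα = toRa k K n α p

variable {k K}

/-- `LocElemSpec P ℘ a aα` : aα ∈ S_α = (R_α)_℘ is the specialization of a ∈ S = R_P,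
i.e. writing a = f/g with f, g ∈ R, g ∉ P, one has g_α ∉ ℘ and aα = f_α/g_α. -/
def LocElemSpec {m n : ℕ} {α : Fin m → K} (P : Ideal (Rg k m n)) [P.IsPrime]
    (℘ : Ideal (Ra k K n α)) [℘.IsPrime]
    {S : Type} [CommRing S] [Algebra (Rg k m n) S] [IsLocalization.AtPrime S P]
    {Sα : Type} [CommRing Sα] [Algebra (Ra k K n α) Sα] [IsLocalization.AtPrime Sα ℘]
    (a : S) (aα : Sα) : Prop :=
  ∃ (f g : Rg k m n) (fα gα : Ra k K n α) (hg : g ∈ P.primeCompl)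
    (hgα : gα ∈ ℘.primeCompl),
    ElemSpec k K n α f fα ∧ ElemSpec k K n α g gα ∧
    a = IsLocalization.mk' S f ⟨g, hg⟩ ∧
    aα = IsLocalization.mk' Sα fα ⟨gα, hgα⟩

/-- entrywise specialization of matrices, relative to an element-specialization
relation `E`. -/
def MatSpec {S T : Type} (E : S → T → Prop) {r s : ℕ}
    (A : Matrix (Fin r) (Fin s) S) (B : Matrix (Fin r) (Fin s) T) : Prop :=
  ∀ i j, E (A i j) (B i j)

/-- the cokernel of the linear map attached to a matrix A, i.e. the module
presented by A. -/
abbrev MatCoker {S : Type} [CommRing S] {r s : ℕ} (A : Matrix (Fin r) (Fin s) S) :=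
  (Fin r → S) ⧸ LinearMap.range A.mulVecLin

/-- a finite free presentation F_1 → F_0 → L → 0 of the module L, where the map
F_1 → F_0 is given by the matrix A and the map F_0 → L is π. -/
structure Present (S : Type) [CommRing S] (r s : ℕ) (L : Type) [AddCommGroup L]
    [Module S L] where
  A : Matrix (Fin r) (Fin s) S
  π : (Fin r → S) →ₗ[S] L
  surj : Function.Surjective π
  ker_eq : LinearMap.ker π = LinearMap.range A.mulVecLin

theorem comm_le {S : Type} [CommRing S] {r s r' s' : ℕ} {B : Matrix (Fin r) (Fin s) S}
    {C : Matrix (Fin r') (Fin s') S} {W : Matrix (Fin r') (Fin r) S}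
    {W1 : Matrix (Fin s') (Fin s) S} (h : W * B = C * W1) :
    LinearMap.range B.mulVecLin ≤ (LinearMap.range C.mulVecLin).comap W.mulVecLin := by
  rintro x ⟨y, rfl⟩
  exact ⟨W1.mulVecLin y, by
    simp only [Matrix.mulVecLin_apply, Matrix.mulVec_mulVec, h]⟩

/-- the map between the modules presented by B and C induced by the matrix W
(a specialization of a lift of a map between the presented modules). -/
def cokerMap {S : Type} [CommRing S] {r s r' s' : ℕ} {B : Matrix (Fin r) (Fin s) S}
    {C : Matrix (Fin r') (Fin s') S} (W : Matrix (Fin r') (Fin r) S)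
    (h : LinearMap.range B.mulVecLin ≤ (LinearMap.range C.mulVecLin).comap W.mulVecLin) :
    MatCoker B →ₗ[S] MatCoker C :=
  Submodule.mapQ _ _ W.mulVecLin h

/-- a lift of a homomorphism v : L → M to given finite free presentations of L and M:
a commutative diagram whose vertical maps are given by the matrices V1, V0. -/
structure MapLift {S : Type} [CommRing S] {rL sL rM sM : ℕ} {L M : Type}
    [AddCommGroup L] [Module S L] [AddCommGroup M] [Module S M]
    (pL : Present S rL sL L) (pM : Present S rM sM M) (v : L →ₗ[S] M) where
  V0 : Matrix (Fin rM) (Fin rL) S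
  V1 : Matrix (Fin sM) (Fin sL) S
  comm0 : pM.π ∘ₗ V0.mulVecLin = v ∘ₗ pL.π
  comm1 : V0 * pL.A = pM.A * V1

/-- Krull dimension of a module, dim L = dim S/Ann L. -/
def moduleDim (S : Type) [CommRing S] (L : Type) [AddCommGroup L] [Module S L] :
    WithBot ℕ∞ :=
  ringKrullDim (S ⧸ Module.annihilator S L)

/-- height of an ideal: the infimum of dim S_p over the primes p ⊇ I. -/
def idealHeight {S : Type} [CommRing S] (I : Ideal S) : WithBot ℕ∞ :=
  sInf { d | ∃ (p : Ideal S) (hp : p.IsPrime), I ≤ p ∧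
    d = ringKrullDim (Localization (@Ideal.primeCompl _ _ p hp)) }

/-- length of a module: the longest chain of submodules. -/
def moduleLength (S : Type) [CommRing S] (L : Type) [AddCommGroup L] [Module S L] :
    WithBot ℕ∞ :=
  Order.krullDim (Submodule S L)

/-- grade(𝔞, L) ≥ t : there is an L-regular sequence of length t in 𝔞. -/
def GradeGE {S : Type} [CommRing S] (𝔞 : Ideal S) (L : Type) [AddCommGroup L]
    [Module S L] (t : ℕ) : Prop :=
  ∃ rs : List S, rs.length = t ∧ (∀ x ∈ rs, x ∈ 𝔞) ∧ RingTheory.Sequence.IsRegular L rs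

/-- grade(𝔞, L) : the length of a maximal L-regular sequence in 𝔞. -/
def grade {S : Type} [CommRing S] (𝔞 : Ideal S) (L : Type) [AddCommGroup L]
    [Module S L] : ℕ∞ :=
  sSup { t : ℕ∞ | ∃ t' : ℕ, t = (t' : ℕ∞) ∧ GradeGE 𝔞 L t' }

/-- depth of a module over a local ring: grade(𝔪, L). -/
def depth (S : Type) [CommRing S] [IsLocalRing S] (L : Type) [AddCommGroup L]
    [Module S L] : ℕ∞ :=
  grade (IsLocalRing.maximalIdeal S) L

/-- proj dim L ≤ d : L admits a finite free resolution of length ≤ d, encoded as a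
(possibly infinite) free resolution ⋯ → F_1 → F_0 → L → 0 with F_j = 0 for j > d. -/
def ProjDimLE (S : Type) [CommRing S] (L : Type) [AddCommGroup L] [Module S L]
    (d : ℕ) : Prop :=
  ∃ (r : ℕ → ℕ) (A : ∀ j : ℕ, Matrix (Fin (r j)) (Fin (r (j + 1))) S)
    (π : (Fin (r 0) → S) →ₗ[S] L),
    Function.Surjective π ∧ LinearMap.ker π = LinearMap.range (A 0).mulVecLin ∧
    (∀ j : ℕ, LinearMap.ker (A j).mulVecLin = LinearMap.range (A (j + 1)).mulVecLin) ∧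
    ∀ j : ℕ, d < j → r j = 0

/-- projective dimension of a module, as an extended natural number. -/
def projDim (S : Type) [CommRing S] (L : Type) [AddCommGroup L] [Module S L] : ℕ∞ :=
  sInf { d : ℕ∞ | ∃ d' : ℕ, d = (d' : ℕ∞) ∧ ProjDimLE S L d' }

/-- the i-th local cohomology module H^i_𝔞(L) as a module. -/
abbrev localCoh {S : Type} [CommRing S] (𝔞 : Ideal S) (i : ℕ) (L : Type)
    [AddCommGroup L] [Module S L] : ModuleCat S :=
  (localCohomology 𝔞 i).obj (ModuleCat.of S L)

/-- the colon submodule (0 :_L 𝔞) = { x ∈ L | 𝔞 x = 0 }. -/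
def colonSubmodule {S : Type} [CommRing S] (𝔞 : Ideal S) (L : Type) [AddCommGroup L]
    [Module S L] : Submodule S L where
  carrier := { x | ∀ c ∈ 𝔞, c • x = 0 }
  add_mem' := by
    intro a b ha hb c hc
    rw [smul_add, ha c hc, hb c hc, add_zero]
  zero_mem' := by
    intro c _
    rw [smul_zero]
  smul_mem' := by
    intro s x hx c hc
    rw [smul_comm, hx c hc, smul_zero]

/-- a (partial) system of parameters: the d = dim L elements a_1, ..., a_d lie in the
maximal ideal and L/(a_1, ..., a_d)L has dimension ≤ 0. -/
def IsSOP (S : Type) [CommRing S] [IsLocalRing S] (L : Type) [AddCommGroup L]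
    [Module S L] {d : ℕ} (a : Fin d → S) : Prop :=
  (∀ i, a i ∈ IsLocalRing.maximalIdeal S) ∧
  moduleDim S L = (d : ℕ∞) ∧
  moduleDim S (L ⧸ (Ideal.span (Set.range a) • (⊤ : Submodule S L))) ≤ 0

/-- a standard system of parameters: (a_1, ..., a_d) H^i_𝔪(L/(a_1, ..., a_j)L) = 0
for all i + j < d. -/
def IsStandardSOP (S : Type) [CommRing S] [IsLocalRing S] (L : Type) [AddCommGroup L]
    [Module S L] {d : ℕ} (a : Fin d → S) : Prop :=
  IsSOP S L a ∧
  ∀ i j : ℕ, i + j < d →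
    Ideal.span (Set.range a) ≤ Module.annihilator S
      (localCoh (IsLocalRing.maximalIdeal S) i
        (L ⧸ (Ideal.span (a '' { x : Fin d | (x : ℕ) < j }) • (⊤ : Submodule S L))))

/-- a standard ideal for L: an 𝔪-primary ideal 𝔞 such that every system of
parameters of L contained in 𝔞 is standard. -/
def IsStandardIdeal (S : Type) [CommRing S] [IsLocalRing S] (L : Type) [AddCommGroup L]
    [Module S L] (𝔞 : Ideal S) : Prop :=
  𝔞.radical = IsLocalRing.maximalIdeal S ∧
  ∀ (d : ℕ) (a : Fin d → S), (∀ i, a i ∈ 𝔞) → IsSOP S L a → IsStandardSOP S L a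


/-- A Gröbner-type finiteness statement: finitely many nonzero elements of `J` have degrees
dividing the degrees of all nonzero elements of `J`. -/
theorem exists_finset_degree_le {U : Type*} [CommRing U] {n : ℕ} (m : MonomialOrder (Fin n))
    (J : Ideal (MvPolynomial (Fin n) U)) :
    ∃ G : Finset (MvPolynomial (Fin n) U), (∀ g ∈ G, g ∈ J ∧ g ≠ 0) ∧
      ∀ F ∈ J, F ≠ 0 → ∃ g ∈ G, m.degree g ≤ m.degree F := by
  classical
  let T : (Fin n →₀ ℕ) → Prop := fun d => ∃ g ∈ J, g ≠ 0 ∧ m.degree g = d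
  have hfin : {d | Minimal T d}.Finite :=
    WellQuasiOrderedLE.finite_of_isAntichain (setOfPred_minimal_antichain T)
  have hT : ∀ d : {d // Minimal T d}, ∃ g ∈ J, g ≠ 0 ∧ m.degree g = d.1 := fun d => d.2.prop
  choose g hgJ hg0 hgd using hT
  have : Fintype {d // Minimal T d} := hfin.fintype
  refine ⟨Finset.univ.image g, ?_, ?_⟩
  · intro x hx
    obtain ⟨d, -, rfl⟩ := Finset.mem_image.1 hx
    exact ⟨hgJ d, hg0 d⟩
  · intro F hF hF0
    obtain ⟨d, hd, hmin⟩ := exists_minimal_le_of_wellFoundedLT T (m.degree F) ⟨F, hF, hF0, rfl⟩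
    exact ⟨g ⟨d, hmin⟩, Finset.mem_image_of_mem _ (Finset.mem_univ _), by rwa [hgd]⟩

/-- Generic vanishing of `Tor₁ (U[X]/J, U/𝔭)` in elementary terms. -/
theorem exists_ne_zero_pow_mul_mem {U : Type*} [CommRing U] [IsDomain U] {n : ℕ}
    (J : Ideal (MvPolynomial (Fin n) U)) :
    ∃ c : U, c ≠ 0 ∧ ∀ (𝔭 : Ideal U) (F : MvPolynomial (Fin n) U), F ∈ J →
      F ∈ 𝔭.map (C : U →+* MvPolynomial (Fin n) U) →
      ∃ N : ℕ, C (c ^ N) * F ∈ 𝔭.map (C : U →+* MvPolynomial (Fin n) U) * J := by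
  classical
  let m : MonomialOrder (Fin n) := MonomialOrder.lex
  obtain ⟨G, hG, hdeg⟩ := exists_finset_degree_le m J
  refine ⟨∏ g ∈ G, m.leadingCoeff g, Finset.prod_ne_zero_iff.2 fun g hg =>
    m.leadingCoeff_ne_zero_iff.2 (hG g hg).2, fun 𝔭 F => ?_⟩
  set c := ∏ g ∈ G, m.leadingCoeff g with hc
  induction hF : m.toSyn (m.degree F) using WellFoundedLT.induction generalizing F with
  | ind s ih =>
    subst hF
    intro hFJ hFp
    by_cases hF0 : F = 0
    · exact ⟨0, by simp [hF0]⟩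
    obtain ⟨g, hgG, hgF⟩ := hdeg F hFJ hF0
    obtain ⟨e, he⟩ := Finset.dvd_prod_of_mem m.leadingCoeff hgG
    rw [← hc] at he
    let t := monomial (m.degree F - m.degree g) (m.leadingCoeff F)
    have hlc : m.leadingCoeff F ∈ 𝔭 := mem_map_C_iff.1 hFp _
    have ht : t ∈ 𝔭.map (C : U →+* MvPolynomial (Fin n) U) := by
      rw [mem_map_C_iff]
      intro d
      rw [coeff_monomial]
      split_ifs
      exacts [hlc, 𝔭.zero_mem]
    let F' := C (m.leadingCoeff g) * F - t * g
    have key : ∃ N : ℕ, C (c ^ N) * F' ∈ 𝔭.map (C : U →+* MvPolynomial (Fin n) U) * J := by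
      by_cases hF'0 : F' = 0
      · exact ⟨0, by simp [hF'0]⟩
      refine ih _ ?_ F' rfl (J.sub_mem (J.mul_mem_left _ hFJ) (J.mul_mem_left _ (hG g hgG).1))
        (Ideal.sub_mem _ (Ideal.mul_mem_left _ _ hFp) (Ideal.mul_mem_right _ _ ht))
      have hle : m.toSyn (m.degree F') ≤ m.toSyn (m.degree F) := by
        refine m.degree_sub_le.trans (sup_le ?_ ?_)
        · refine m.degree_mul_le.trans ?_
          rw [m.degree_C, zero_add]
        · refine m.degree_mul_le.trans ?_
          have h1 := m.degree_monomial_le (d := m.degree F - m.degree g) (m.leadingCoeff F)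
          have h2 := add_le_add_left h1 (m.toSyn (m.degree g))
          rw [← map_add, ← map_add, tsub_add_cancel_of_le hgF] at h2
          exact h2
      refine lt_of_le_of_ne hle fun heq => hF'0 ?_
      rw [← m.leadingCoeff_eq_zero_iff, MonomialOrder.leadingCoeff, m.toSyn.injective heq]
      simp only [F', t, coeff_sub, coeff_C_mul, coeff_monomial_mul', tsub_le_self, if_true,
        tsub_tsub_cancel_of_le hgF]
      simp only [MonomialOrder.leadingCoeff]
      ring
    obtain ⟨N, hN⟩ := key
    refine ⟨N + 1, ?_⟩
    have h1 : C (c ^ N) * C (m.leadingCoeff g) * F ∈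
        𝔭.map (C : U →+* MvPolynomial (Fin n) U) * J := by
      have h2 : C (c ^ N) * (t * g) ∈ 𝔭.map (C : U →+* MvPolynomial (Fin n) U) * J :=
        Ideal.mul_mem_left _ _ (Ideal.mul_mem_mul ht (hG g hgG).1)
      have h3 := Ideal.add_mem _ hN h2
      convert h3 using 1
      simp only [F']
      ring
    have h4 := Ideal.mul_mem_left _ (C e) h1
    convert h4 using 1
    rw [pow_succ]
    nth_rewrite 2 [he]
    simp only [C_mul]
    ring

/-- Common denominators for the coefficients of a polynomial over a field of fractions of the
image of `e`. -/
theorem exists_C_mul_eq_map {U κ : Type*} [CommRing U] [Field κ] {n : ℕ} (e : U →+* κ)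
    (he : ∀ x : κ, ∃ a b : U, e b ≠ 0 ∧ e b * x = e a) (w : MvPolynomial (Fin n) κ) :
    ∃ (b : U) (Y : MvPolynomial (Fin n) U), e b ≠ 0 ∧ MvPolynomial.map e Y = C (e b) * w := by
  induction w using MvPolynomial.induction_on with
  | C x =>
    obtain ⟨a, b, hb, h⟩ := he x
    exact ⟨b, C a, hb, by rw [map_C, ← h, C_mul]⟩
  | add p q hp hq =>
    obtain ⟨b, Y, hb, h⟩ := hp
    obtain ⟨b', Y', hb', h'⟩ := hq
    refine ⟨b * b', C b' * Y + C b * Y', by simp [hb, hb'], ?_⟩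
    simp only [map_add, map_mul, map_C, h, h']
    ring
  | mul_X p i hp =>
    obtain ⟨b, Y, hb, h⟩ := hp
    exact ⟨b, Y * X i, hb, by rw [map_mul, h, map_X, mul_assoc]⟩

/-- Generically, every syzygy of the specialized tuple `f` is, up to a nonzero constant, the
specialization of a syzygy of `f`. -/
theorem exists_ne_zero_syzygy_lift {U : Type*} [CommRing U] [IsDomain U] {n : ℕ}
    {ι : Type*} [Fintype ι] (f : ι → MvPolynomial (Fin n) U) :
    ∃ c : U, c ≠ 0 ∧ ∀ (κ : Type*) [Field κ] (e : U →+* κ),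
      (∀ x : κ, ∃ a b : U, e b ≠ 0 ∧ e b * x = e a) → e c ≠ 0 →
      ∀ w : ι → MvPolynomial (Fin n) κ, ∑ i, w i * MvPolynomial.map e (f i) = 0 →
        ∃ (σ : ι → MvPolynomial (Fin n) U) (d : κ), d ≠ 0 ∧ ∑ i, σ i * f i = 0 ∧
          ∀ i, MvPolynomial.map e (σ i) = C d * w i := by
  classical
  obtain ⟨c, hc0, hc⟩ := exists_ne_zero_pow_mul_mem (Ideal.span (Set.range f))
  refine ⟨c, hc0, fun κ _ e he hec w hw => ?_⟩
  choose b Y hb hY using fun i => exists_C_mul_eq_map e he (w i)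
  let Y' : ι → MvPolynomial (Fin n) U := fun i => C (∏ j ∈ Finset.univ.erase i, b j) * Y i
  have hY' : ∀ i, MvPolynomial.map e (Y' i) = C (e (∏ j, b j)) * w i := by
    intro i
    simp only [Y', map_mul, map_C, hY]
    rw [← mul_assoc, ← C_mul, ← map_mul, Finset.prod_erase_mul _ _ (Finset.mem_univ i)]
  have hB : e (∏ j, b j) ≠ 0 := by
    rw [map_prod]
    exact Finset.prod_ne_zero_iff.2 fun i _ => hb i
  obtain ⟨N, hN⟩ := hc (RingHom.ker e) (∑ i, Y' i * f i)
    (Ideal.sum_mem _ fun i _ => Ideal.mul_mem_left _ _ (Ideal.subset_span ⟨i, rfl⟩)) (by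
      rw [mem_map_C_iff]
      intro d
      rw [RingHom.mem_ker, ← coeff_map]
      simp only [map_sum, map_mul, hY', mul_assoc]
      rw [← Finset.mul_sum, hw, mul_zero, coeff_zero])
  rw [← smul_eq_mul, ← Ideal.submodule_span_eq,
    Submodule.mem_ideal_smul_span_iff_exists_sum] at hN
  obtain ⟨Z, hZ, hsum⟩ := hN
  rw [Finsupp.sum_fintype _ _ (by simp)] at hsum
  refine ⟨fun i => C (c ^ N) * Y' i - Z i, e (c ^ N) * e (∏ j, b j),
    mul_ne_zero (by simpa using pow_ne_zero N hec) hB, ?_, fun i => ?_⟩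
  · simp only [sub_mul, Finset.sum_sub_distrib, mul_assoc, ← Finset.mul_sum]
    simp only [smul_eq_mul] at hsum
    rw [hsum, sub_self]
  · have hZ0 : MvPolynomial.map e (Z i) = 0 := by
      ext d
      rw [coeff_map, coeff_zero]
      exact mem_map_C_iff.1 (hZ i) d
    rw [map_sub, hZ0, sub_zero, map_mul, hY', map_C, C_mul, mul_assoc]

/-- Finitely many conditions that are stable under multiples and can each be met in a submonoid
can be met simultaneously. -/
theorem exists_mem_forall_of_stable {V ι : Type*} [CommMonoid V] [Finite ι] (M : Submonoid V)
    (Q : ι → V → Prop) (hmul : ∀ i x y, Q i x → Q i (y * x)) (h : ∀ i, ∃ x ∈ M, Q i x) :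
    ∃ x ∈ M, ∀ i, Q i x := by
  classical
  cases nonempty_fintype ι
  choose x hx hQ using h
  refine ⟨∏ i, x i, Submonoid.prod_mem _ fun i _ => hx i, fun i => ?_⟩
  rw [← Finset.prod_erase_mul _ _ (Finset.mem_univ i)]
  exact hmul _ _ _ (hQ i)

/-- A finitely generated submodule that is elementwise pushed into `N` by elements of `M` is
pushed into `N` by a single element of `M`. -/
theorem exists_mem_smul_mem_of_fg {V E : Type*} [CommRing V] [AddCommGroup E] [Module V E]
    (M : Submonoid V) {L N : Submodule V E} (hL : L.FG) (h : ∀ y ∈ L, ∃ x ∈ M, x • y ∈ N) :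
    ∃ x ∈ M, ∀ y ∈ L, x • y ∈ N := by
  obtain ⟨G, rfl⟩ := hL
  obtain ⟨x, hx, hxG⟩ := exists_mem_forall_of_stable (ι := G) M (fun g x => x • (g : E) ∈ N)
    (fun g x y hg => by rw [mul_smul]; exact N.smul_mem y hg)
    (fun g => h g (Submodule.subset_span g.2))
  refine ⟨x, hx, fun y hy => ?_⟩
  have : Submodule.span V (G : Set E) ≤ N.comap (LinearMap.lsmul V E x) :=
    Submodule.span_le.2 fun g hg => hxG ⟨g, hg⟩
  exact this hy

/-- A finite vector over a localization has a common denominator. -/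
theorem exists_mem_mul_eq_algebraMap {V S ι : Type*} [CommRing V] [CommRing S] [Algebra V S]
    [Finite ι] (M : Submonoid V) [IsLocalization M S] (y : ι → S) :
    ∃ x ∈ M, ∃ z : ι → V, ∀ i, algebraMap V S x * y i = algebraMap V S (z i) := by
  obtain ⟨x, hx⟩ := IsLocalization.exist_integer_multiples_of_finite M y
  choose z hz using hx
  exact ⟨x, x.2, z, fun i => by rw [hz, Algebra.smul_def]⟩

theorem apply_eq_sum_mul {S : Type*} [CommRing S] {r : ℕ} (b : (Fin r → S) →ₗ[S] S)
    (y : Fin r → S) : b y = ∑ i, y i * b (Pi.single i 1) := by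
  conv_lhs => rw [pi_eq_sum_univ' y]
  simp [map_sum]

/-- Clearing denominators in a finite presentation of an extended ideal. -/
theorem exists_denominators {V S : Type*} [CommRing V] [IsDomain V] [IsNoetherianRing V]
    [CommRing S] [Algebra V S] (M : Submonoid V) (hM : M ≤ nonZeroDivisors V)
    [IsLocalization M S] (J : Ideal V)
    {r s : ℕ} (A : Matrix (Fin r) (Fin s) S) (b : (Fin r → S) →ₗ[S] S)
    (hrange : ∀ x, x ∈ LinearMap.range b ↔ x ∈ J.map (algebraMap V S))
    (hker : LinearMap.ker b = LinearMap.range A.mulVecLin) :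
    ∃ h ∈ M, ∃ H ∈ M, ∃ (a : Matrix (Fin r) (Fin s) V) (f : Fin r → V),
      (∀ i j, algebraMap V S h * A i j = algebraMap V S (a i j)) ∧
      (∀ i, f i ∈ J) ∧
      (∀ x ∈ J, H * x ∈ Ideal.span (Set.range f)) ∧
      (∀ σ : Fin r → V, ∑ i, σ i * f i = 0 → ∃ τ : Fin s → V, H • σ = a.mulVec τ) ∧
      (∀ j, ∑ i, a i j * f i = 0) := by
  have hinj : Function.Injective (algebraMap V S) := IsLocalization.injective S hM
  obtain ⟨h, hh, a', ha'⟩ := exists_mem_mul_eq_algebraMap M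
    (fun q : Fin r × Fin s => A q.1 q.2)
  set a : Matrix (Fin r) (Fin s) V := fun i j => a' (i, j)
  have ha : ∀ i j, algebraMap V S h * A i j = algebraMap V S (a i j) := fun i j => ha' (i, j)
  obtain ⟨d, hd, hf⟩ := exists_mem_forall_of_stable M
    (fun (i : Fin r) x => ∃ f ∈ J, algebraMap V S x * b (Pi.single i 1) = algebraMap V S f)
    (by
      rintro i x y ⟨f, hf, hxf⟩
      exact ⟨y * f, J.mul_mem_left _ hf, by rw [map_mul, map_mul, mul_assoc, hxf]⟩)
    (fun i => by
      obtain ⟨⟨f, x⟩, hfx⟩ := (IsLocalization.mem_map_algebraMap_iff M S).1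
        ((hrange (b (Pi.single i 1))).1 ⟨_, rfl⟩)
      exact ⟨x, x.2, f, f.2, by rw [mul_comm, hfx]⟩)
  choose f hfJ hfb using hf
  have hbsum : ∀ y : Fin r → S,
      algebraMap V S d * b y = ∑ i, y i * algebraMap V S (f i) := by
    intro y
    rw [apply_eq_sum_mul, Finset.mul_sum]
    exact Finset.sum_congr rfl fun i _ => by rw [← hfb]; ring
  have hspan : ∀ x ∈ J, ∃ c ∈ M, c • x ∈ Ideal.span (Set.range f) := by
    intro x hx
    obtain ⟨y, hy⟩ := (hrange _).2 (Ideal.mem_map_of_mem (algebraMap V S) hx)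
    obtain ⟨c, hc, z, hz⟩ := exists_mem_mul_eq_algebraMap M y
    refine ⟨c * d, M.mul_mem hc hd, ?_⟩
    have : (c * d) • x = ∑ i, z i * f i := by
      apply hinj
      rw [smul_eq_mul, map_mul, map_mul, ← hy, mul_assoc, hbsum, Finset.mul_sum, map_sum]
      exact Finset.sum_congr rfl fun i _ => by rw [map_mul, ← hz, mul_assoc]
    rw [this]
    exact Ideal.sum_mem _ fun i _ => Ideal.mul_mem_left _ _ (Ideal.subset_span ⟨i, rfl⟩)
  have hsyz : ∀ σ ∈ LinearMap.ker (Fintype.linearCombination V f),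
      ∃ c ∈ M, c • σ ∈ LinearMap.range a.mulVecLin := by
    intro σ hσ
    rw [LinearMap.mem_ker, Fintype.linearCombination_apply] at hσ
    have hb0 : (fun i => algebraMap V S (σ i)) ∈ LinearMap.ker b := by
      rw [LinearMap.mem_ker]
      refine (IsLocalization.map_units S ⟨d, hd⟩).mul_right_eq_zero.1 ?_
      rw [hbsum]
      simp only [smul_eq_mul] at hσ
      simp only [← map_mul, ← map_sum, hσ, map_zero]
    rw [hker] at hb0
    obtain ⟨τ, hτ⟩ := hb0
    obtain ⟨c, hc, t, ht⟩ := exists_mem_mul_eq_algebraMap M τ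
    refine ⟨h * c, M.mul_mem hh hc, t, ?_⟩
    ext i
    apply hinj
    have hi : ∑ j, A i j * τ j = algebraMap V S (σ i) := congrFun hτ i
    rw [Matrix.mulVecLin_apply, Matrix.mulVec, dotProduct, map_sum, Pi.smul_apply, smul_eq_mul,
      map_mul, map_mul, ← hi, Finset.mul_sum]
    exact Finset.sum_congr rfl fun j _ => by rw [map_mul, ← ha, ← ht]; ring
  obtain ⟨H₁, hH₁, hJ⟩ := exists_mem_smul_mem_of_fg M (IsNoetherian.noetherian J) hspan
  obtain ⟨H₂, hH₂, hS⟩ := exists_mem_smul_mem_of_fg M (IsNoetherian.noetherian _) hsyz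
  refine ⟨h, hh, H₁ * H₂, M.mul_mem hH₁ hH₂, a, f, ha, hfJ, fun x hx => ?_, fun σ hσ => ?_,
    fun j => ?_⟩
  · rw [mul_comm H₁, mul_assoc]
    exact Ideal.mul_mem_left _ _ (hJ x hx)
  · obtain ⟨τ, hτ⟩ := Submodule.smul_mem _ H₁
      (hS σ (by rwa [LinearMap.mem_ker, Fintype.linearCombination_apply]))
    exact ⟨τ, by rw [mul_smul, ← hτ, Matrix.mulVecLin_apply]⟩
  · apply hinj
    have h0 : b (A.mulVecLin (Pi.single j 1)) = 0 := by
      rw [← LinearMap.mem_ker, hker]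
      exact ⟨_, rfl⟩
    have h1 := hbsum (A.mulVecLin (Pi.single j 1))
    rw [h0, mul_zero] at h1
    simp only [Matrix.mulVecLin_apply, Matrix.mulVec_single_one, Matrix.col_apply] at h1
    simp only [map_sum, map_mul, ← ha, mul_assoc, map_zero]
    rw [← Finset.mul_sum, ← h1, mul_zero]

/-- If syzygies of `φ ∘ f` lift to syzygies of `f`, a matrix presenting the extension of `J`
specializes to a matrix presenting the extension of `J.map φ`. -/
theorem nonempty_matCoker_equiv {V W T : Type} [CommRing V] [CommRing W] [IsDomain W]
    [CommRing T] [Algebra W T] (M : Submonoid W) (hM : M ≤ nonZeroDivisors W)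
    [IsLocalization M T] (φ : V →+* W) (J : Ideal V) {r s : ℕ}
    {h H : V} (hh : φ h ∈ M) (hH : φ H ∈ M) {a : Matrix (Fin r) (Fin s) V} {f : Fin r → V}
    {B : Matrix (Fin r) (Fin s) T}
    (hB : ∀ i j, algebraMap W T (φ h) * B i j = algebraMap W T (φ (a i j)))
    (hf : ∀ i, f i ∈ J) (hspan : ∀ x ∈ J, H * x ∈ Ideal.span (Set.range f))
    (hsyz : ∀ σ : Fin r → V, ∑ i, σ i * f i = 0 → ∃ τ : Fin s → V, H • σ = a.mulVec τ)
    (ha : ∀ j, ∑ i, a i j * f i = 0)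
    (hlift : ∀ w : Fin r → W, ∑ i, w i * φ (f i) = 0 →
      ∃ (σ : Fin r → V) (d : W), d ∈ M ∧ ∑ i, σ i * f i = 0 ∧ ∀ i, φ (σ i) = d * w i) :
    Nonempty (MatCoker B ≃ₗ[T] (J.map φ).map (algebraMap W T)) := by
  have hinj : Function.Injective (algebraMap W T) := IsLocalization.injective T hM
  let ψ : (Fin r → T) →ₗ[T] T := Fintype.linearCombination T fun i => algebraMap W T (φ (f i))
  have hψ : ∀ y, ψ y = ∑ i, y i * algebraMap W T (φ (f i)) := fun y => by
    simp [ψ, Fintype.linearCombination_apply]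
  have hrange : LinearMap.range ψ = (J.map φ).map (algebraMap W T) := by
    apply le_antisymm
    · rintro _ ⟨y, rfl⟩
      rw [hψ]
      exact Ideal.sum_mem _ fun i _ => Ideal.mul_mem_left _ _
        (Ideal.mem_map_of_mem _ (Ideal.mem_map_of_mem _ (hf i)))
    · rw [Ideal.map_map]
      refine Ideal.map_le_iff_le_comap.2 fun x hx => ?_
      change algebraMap W T (φ x) ∈ LinearMap.range ψ
      obtain ⟨z, hz⟩ := Ideal.mem_span_range_iff_exists_fun.1 (hspan x hx)
      obtain ⟨u, hu⟩ := IsLocalization.map_units T ⟨φ H, hH⟩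
      refine ⟨fun i => (↑u⁻¹ : T) * algebraMap W T (φ (z i)), ?_⟩
      rw [hψ]
      simp only [mul_assoc, ← map_mul, ← Finset.mul_sum, ← map_sum]
      rw [hz, map_mul, map_mul, Units.inv_mul_eq_iff_eq_mul, hu]
  have hker : LinearMap.range B.mulVecLin = LinearMap.ker ψ := by
    have hu := IsLocalization.map_units T ⟨φ h, hh⟩
    apply le_antisymm
    · rintro _ ⟨y, rfl⟩
      rw [LinearMap.mem_ker, hψ]
      refine hu.mul_right_eq_zero.1 ?_
      simp only [Matrix.mulVecLin_apply, Matrix.mulVec, dotProduct, Finset.sum_mul,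
        Finset.mul_sum]
      rw [Finset.sum_comm]
      refine Finset.sum_eq_zero fun j _ => ?_
      calc ∑ i, algebraMap W T (φ h) * (B i j * y j * algebraMap W T (φ (f i)))
          = ∑ i, y j * algebraMap W T (φ (a i j * f i)) :=
            Finset.sum_congr rfl fun i _ => by rw [map_mul, map_mul, ← hB]; ring
        _ = 0 := by rw [← Finset.mul_sum, ← map_sum, ← map_sum, ha, map_zero, map_zero, mul_zero]
    · intro y hy
      rw [LinearMap.mem_ker, hψ] at hy
      obtain ⟨c, hc, w, hw⟩ := exists_mem_mul_eq_algebraMap M y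
      obtain ⟨σ, d, hd, hσ, hσw⟩ := hlift w (by
        apply hinj
        simp only [map_sum, map_mul, ← hw, mul_assoc, map_zero]
        rw [← Finset.mul_sum, hy, mul_zero])
      obtain ⟨τ, hτ⟩ := hsyz σ hσ
      obtain ⟨u, hu'⟩ := IsLocalization.map_units T
        ⟨φ H * (d * c), M.mul_mem hH (M.mul_mem hd hc)⟩
      refine (Submodule.smul_mem_iff_of_isUnit _ u.isUnit).1
        ⟨fun j => algebraMap W T (φ h) * algebraMap W T (φ (τ j)), ?_⟩
      ext i
      have hi : H * σ i = ∑ j, a i j * τ j := congrFun hτ i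
      rw [Pi.smul_apply, smul_eq_mul, hu']
      simp only [map_mul, mul_assoc, hw]
      simp only [← map_mul]
      rw [← hσw, ← map_mul, hi, Matrix.mulVecLin_apply, Matrix.mulVec, dotProduct, map_sum,
        map_sum]
      exact Finset.sum_congr rfl fun j _ => by
        simp only [map_mul, ← hB]; ring
  exact ⟨(Submodule.quotEquivOfEq _ _ hker).trans
    (ψ.quotKerEquivRange.trans (LinearEquiv.ofEq _ _ hrange))⟩

/-- Generically, the specialization of an element outside a prime ideal `Q` is a nonzerodivisor
modulo the specialization of `Q`. -/
theorem exists_ne_zero_mem_of_mul_mem {U : Type*} [CommRing U] [IsDomain U] [IsNoetherianRing U]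
    {n : ℕ} (Q : Ideal (MvPolynomial (Fin n) U)) [Q.IsPrime] {H : MvPolynomial (Fin n) U}
    (hH : H ∉ Q) :
    ∃ c : U, c ≠ 0 ∧ ∀ (κ : Type) [Field κ] (e : U →+* κ),
      (∀ x : κ, ∃ a b : U, e b ≠ 0 ∧ e b * x = e a) → e c ≠ 0 →
      ∀ y : MvPolynomial (Fin n) κ, y * MvPolynomial.map e H ∈ Q.map (MvPolynomial.map e) →
        y ∈ Q.map (MvPolynomial.map e) := by
  obtain ⟨t, g, hg⟩ := Submodule.fg_iff_exists_fin_generating_family.1 (IsNoetherian.noetherian Q)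
  obtain ⟨c, hc0, hc⟩ := exists_ne_zero_syzygy_lift
    (fun o : Option (Fin t) => o.elim H g)
  have hgQ : ∀ i, g i ∈ Q := fun i => hg ▸ Submodule.subset_span ⟨i, rfl⟩
  refine ⟨c, hc0, fun κ _ e he hec y hy => ?_⟩
  have hmap : Q.map (MvPolynomial.map e) =
      Ideal.span (Set.range fun i => MvPolynomial.map e (g i)) := by
    rw [← hg, Ideal.submodule_span_eq, Ideal.map_span, ← Set.range_comp]
    rfl
  obtain ⟨z, hz⟩ := Ideal.mem_span_range_iff_exists_fun.1 (hmap ▸ hy)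
  obtain ⟨σ, d, hd, hσ, hσw⟩ := hc κ e he hec (fun o => o.elim y fun i => -z i) (by
    simp only [Fintype.sum_option, Option.elim, neg_mul, Finset.sum_neg_distrib]
    rw [hz, add_neg_cancel])
  rw [Fintype.sum_option] at hσ
  have hmem : σ none * H ∈ Q := by
    have h0 : σ none * H = _ := eq_neg_of_add_eq_zero_left hσ
    rw [h0]
    exact Q.neg_mem (Ideal.sum_mem _ fun i _ => Ideal.mul_mem_left _ _ (hgQ i))
  have h1 := Ideal.mem_map_of_mem (MvPolynomial.map e)
    ((Ideal.IsPrime.mem_or_mem ‹_› hmem).resolve_right hH)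
  rw [hσw none] at h1
  have h2 := Ideal.mul_mem_left _ (C d⁻¹) h1
  rwa [← mul_assoc, ← C_mul, inv_mul_cancel₀ hd, C_1, one_mul] at h2

/-- A nonzerodivisor modulo `L` lies in no associated prime of `R ⧸ L`. -/
theorem not_mem_of_isAssociatedPrime {R : Type*} [CommRing R] {L q : Ideal R}
    (hq : IsAssociatedPrime q (R ⧸ L)) {x : R} (hx : ∀ y, y * x ∈ L → y ∈ L) : x ∉ q := by
  obtain ⟨y, hy⟩ := hq.eq_radical_colon
  obtain ⟨y, rfl⟩ := Ideal.Quotient.mk_surjective y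
  have hcolon : ∀ z, z ∈ Submodule.colon (⊥ : Submodule R (R ⧸ L)) {Ideal.Quotient.mk L y} ↔
      y * z ∈ L := fun z => by
    rw [Submodule.mem_colon_singleton, Submodule.mem_bot, Algebra.smul_def,
      Ideal.Quotient.algebraMap_eq, ← map_mul, Ideal.Quotient.eq_zero_iff_mem, mul_comm]
  have hpow : ∀ N : ℕ, ∀ z, z * x ^ N ∈ L → z ∈ L := by
    intro N
    induction N with
    | zero => intro z hz; simpa using hz
    | succ N ih =>
      intro z hz
      exact ih z (hx _ (by rwa [mul_assoc, ← pow_succ]))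
  intro hxq
  rw [hy] at hxq
  obtain ⟨N, hN⟩ := hxq
  refine hq.isPrime.ne_top ((Ideal.eq_top_iff_one _).2 ?_)
  rw [hy]
  refine Ideal.le_radical ((hcolon 1).2 ?_)
  rw [mul_one]
  exact hpow N y ((hcolon _).1 hN)

theorem coe_evalα {m : ℕ} (α : Fin m → K) (c : MvPolynomial (Fin m) k) :
    (evalα k K α c : K) = MvPolynomial.aeval α c := by
  have h : (kA k K α).val.comp (MvPolynomial.aeval fun i =>
      (⟨α i, IntermediateField.subset_adjoin k (Set.range α) ⟨i, rfl⟩⟩ : kA k K α)) =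
      MvPolynomial.aeval α := by
    ext i
    simp
  exact DFunLike.congr_fun h c

theorem exists_evalα_mul_eq {m : ℕ} (α : Fin m → K) (x : kA k K α) :
    ∃ a b : MvPolynomial (Fin m) k, evalα k K α b ≠ 0 ∧ evalα k K α b * x = evalα k K α a := by
  obtain ⟨a, b, hx⟩ := (IntermediateField.mem_adjoin_range_iff k α (x : K)).1 x.2
  by_cases hb : MvPolynomial.aeval α b = 0
  · rw [hb, div_zero] at hx
    have hx0 : x = 0 := Subtype.ext hx
    exact ⟨0, 1, by simp, by simp [hx0]⟩
  · refine ⟨a, b, fun h => hb ?_, ?_⟩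
    · rw [← coe_evalα, h]
      rfl
    · apply Subtype.ext
      change (evalα k K α b : K) * (x : K) = evalα k K α a
      rw [coe_evalα, coe_evalα, hx, mul_div_cancel₀ _ hb]

/-- A property holding off the zero locus of a nonzero polynomial over `k` holds for almost
all `α`. -/
theorem almostAll_of_evalα_ne_zero {m : ℕ} {Q : (Fin m → K) → Prop}
    (c : MvPolynomial (Fin m) k) (hc : c ≠ 0) (h : ∀ α, evalα k K α c ≠ 0 → Q α) :
    AlmostAll K m Q := by
  refine ⟨MvPolynomial.map (algebraMap k K) c, fun h0 => hc ?_, fun α hα => h α fun h0 => hα ?_⟩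
  · exact MvPolynomial.map_injective _ (algebraMap k K).injective (by rw [h0, map_zero])
  · rw [MvPolynomial.eval_map, ← MvPolynomial.aeval_def, ← coe_evalα, h0]
    rfl

/-- Fractions of elements of `k[u][X]` suffice to describe specializations. -/
theorem LocElemSpec.exists_polynomial {m n : ℕ} {α : Fin m → K} {P : Ideal (Rg k m n)} [P.IsPrime]
    {℘ : Ideal (Ra k K n α)} [℘.IsPrime]
    {S : Type} [CommRing S] [Algebra (Rg k m n) S] [IsLocalization.AtPrime S P]
    {Sα : Type} [CommRing Sα] [Algebra (Ra k K n α) Sα] [IsLocalization.AtPrime Sα ℘]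
    {a : S} {aα : Sα} (h : LocElemSpec P ℘ a aα) :
    ∃ f g : MvPolynomial (Fin n) (MvPolynomial (Fin m) k), toRa k K n α g ∈ ℘.primeCompl ∧
      algebraMap _ S (toR k m n g) * a = algebraMap _ S (toR k m n f) ∧
      algebraMap _ Sα (toRa k K n α g) * aα = algebraMap _ Sα (toRa k K n α f) := by
  obtain ⟨f, g, fα, gα, hg, hgα, ⟨p, q, hq, hp, hpα⟩, ⟨p', q', hq', hp', hpα'⟩, rfl, rfl⟩ := h
  have hC : ∀ q, toR k m n (C q) = C (algebraMap _ (kU k m) q) := fun q => by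
    simp [toR]
  have hCα : ∀ q, toRa k K n α (C q) = C (evalα k K α q) := fun q => by
    simp [toRa]
  have hunit : ∀ q, evalα k K α q ≠ 0 → (C (evalα k K α q) : Ra k K n α) ∈ ℘.primeCompl := by
    intro q hq hmem
    exact Ideal.IsPrime.ne_top ‹_› (Ideal.eq_top_of_isUnit_mem _ hmem ((Ne.isUnit hq).map C))
  have h1 := IsLocalization.mk'_spec' S f (⟨g, hg⟩ : P.primeCompl)
  have h2 := IsLocalization.mk'_spec' Sα fα (⟨gα, hgα⟩ : ℘.primeCompl)
  refine ⟨p * C q', p' * C q, ?_, ?_, ?_⟩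
  · rw [map_mul, ← hpα', hCα]
    exact Submonoid.mul_mem _ (Submonoid.mul_mem _ (hunit _ hq') hgα) (hunit _ hq)
  · rw [map_mul, map_mul (toR k m n) p, ← hp', ← hp, hC, hC]
    simp only [map_mul]
    rw [← h1]
    ring
  · rw [map_mul, map_mul (toRa k K n α) p, ← hpα', ← hpα, hCα, hCα]
    simp only [map_mul]
    rw [← h2]
    ring

/-- for an ideal `I` of `R`, the specialization of the `S`-module
`IS` satisfies `(IS)_α ≅ I_α S_α` for almost all `α`: if the `S`-module `IS` is
presented by the matrix `p.A`, then for any specialization `B` of `p.A` the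
`S_α`-module presented by `B` is isomorphic to the extension `I_α S_α` of Krull's
specialization `I_α` to `S_α = (R_α)_℘`. -/
theorem specialization_of_extended_ideal
    (k K : Type) [Field k] [Field K] [Algebra k K] [Infinite K] {m n : ℕ}
    (P : Ideal (Rg k m n)) [P.IsPrime]
    (S : Type) [CommRing S] [Algebra (Rg k m n) S] [IsLocalization.AtPrime S P]
    (I : Ideal (Rg k m n)) {r s : ℕ}
    (p : Present S r s (I.map (algebraMap (Rg k m n) S))) :
    AlmostAll K m fun α =>
      ∀ (℘ : Ideal (Ra k K n α))
        (h℘ : IsAssociatedPrime ℘ ((Ra k K n α) ⧸ idealSpec k K n α P)),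
        haveI := h℘.isPrime
        ∀ (Sα : Type) [CommRing Sα] [Algebra (Ra k K n α) Sα]
          [IsLocalization.AtPrime Sα ℘]
          (B : Matrix (Fin r) (Fin s) Sα),
          MatSpec (LocElemSpec P ℘) p.A B →
          Nonempty ((MatCoker B) ≃ₗ[Sα]
            ((idealSpec k K n α I).map (algebraMap (Ra k K n α) Sα))) := by
  classical
  let U := MvPolynomial (Fin m) k
  let V := MvPolynomial (Fin n) U
  let : Algebra V (Rg k m n) := MvPolynomial.algebraMvPolynomial
  let : Algebra V S := ((algebraMap (Rg k m n) S).comp (toR k m n)).toAlgebra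
  have : IsScalarTower V (Rg k m n) S := IsScalarTower.of_algebraMap_eq fun _ => rfl
  let N : Submonoid V := (nonZeroDivisors U).map (C : U →+* V)
  have : IsLocalization N (Rg k m n) := MvPolynomial.isLocalization _ _
  let Q : Ideal V := P.comap (toR k m n)
  have : Q.IsPrime := Ideal.IsPrime.comap _
  have : IsLocalization.AtPrime S Q :=
    IsLocalization.isLocalization_isLocalization_atPrime_isLocalization N S P
  let J : Ideal V := I.comap (toR k m n)
  have hJ : J.map (algebraMap V S) = I.map (algebraMap (Rg k m n) S) := by
    rw [← IsLocalization.map_under N (Rg k m n) I, Ideal.map_map]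
    rfl
  let b : (Fin r → S) →ₗ[S] S := (Submodule.subtype _).comp p.π
  have hrange : ∀ x, x ∈ LinearMap.range b ↔ x ∈ J.map (algebraMap V S) := by
    intro x
    rw [hJ]
    constructor
    · rintro ⟨y, rfl⟩
      exact (p.π y).2
    · intro hx
      obtain ⟨y, hy⟩ := p.surj ⟨x, hx⟩
      exact ⟨y, congrArg Subtype.val hy⟩
  have hker : LinearMap.ker b = LinearMap.range p.A.mulVecLin := by
    rw [← p.ker_eq]
    exact LinearMap.ker_comp_of_ker_eq_bot _ (Submodule.ker_subtype _)
  obtain ⟨h, hh, H, hH, a, f, ha, hfJ, hspan, hsyz, haf⟩ :=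
    exists_denominators Q.primeCompl Q.primeCompl_le_nonZeroDivisors J p.A b hrange hker
  obtain ⟨c₁, hc₁, hlift⟩ := exists_ne_zero_syzygy_lift f
  obtain ⟨c₂, hc₂, hreg⟩ := exists_ne_zero_mem_of_mul_mem Q
    (H := h * H) (Q.primeCompl.mul_mem hh hH)
  refine almostAll_of_evalα_ne_zero (c₁ * c₂) (mul_ne_zero hc₁ hc₂) fun α hα ℘ h℘ => ?_
  have := h℘.isPrime
  intro Sα _ _ _ B hB
  rw [map_mul] at hα
  have hmem : toRa k K n α (h * H) ∉ ℘ := not_mem_of_isAssociatedPrime h℘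
    (hreg _ (evalα k K α) (exists_evalα_mul_eq α) (right_ne_zero_of_mul hα))
  rw [map_mul] at hmem
  have hhα : toRa k K n α h ∈ ℘.primeCompl := fun h0 => hmem (Ideal.mul_mem_right _ _ h0)
  have hHα : toRa k K n α H ∈ ℘.primeCompl := fun h0 => hmem (Ideal.mul_mem_left _ _ h0)
  refine nonempty_matCoker_equiv ℘.primeCompl ℘.primeCompl_le_nonZeroDivisors (toRa k K n α) J
    hhα hHα (fun i j => ?_) hfJ hspan hsyz haf fun w hw => ?_
  · obtain ⟨f', g', hg', h1, h2⟩ := (hB i j).exists_polynomial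
    have h3 : f' * h = a i j * g' := by
      apply IsLocalization.injective S Q.primeCompl_le_nonZeroDivisors
      change algebraMap V S g' * _ = algebraMap V S f' at h1
      rw [map_mul, map_mul, ← h1, ← ha]
      ring
    have h4 := congrArg (fun v => algebraMap (Ra k K n α) Sα (toRa k K n α v)) h3
    simp only [map_mul] at h4
    refine (IsLocalization.map_units Sα (⟨_, hg'⟩ : ℘.primeCompl)).mul_left_cancel ?_
    change algebraMap _ Sα (toRa k K n α g') * _ = algebraMap _ Sα (toRa k K n α g') * _
    rw [mul_left_comm, h2, mul_comm, h4, mul_comm]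
  · obtain ⟨σ, d, hd, hσ, hσw⟩ := hlift _ (evalα k K α) (exists_evalα_mul_eq α)
      (left_ne_zero_of_mul hα) w hw
    refine ⟨σ, C d, fun h0 => ?_, hσ, hσw⟩
    exact h℘.isPrime.ne_top (Ideal.eq_top_of_isUnit_mem _ h0 ((Ne.isUnit hd).map C))

end Spl
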